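/- arXiv:1106.5116 — 2 statements merged into one kernel-verified Lean document; each statement's English description precedes it below -/
import Mathlib

section
/- Let ω₁ denote the set of all countable ordinals (the first uncountable ordinal) and let U : ω₁ → 𝒫(ω₁) be an arbitrary assignment of subsets of ω₁; for a finite set F ⊆ ω₁ write U_F = ⋂{U_γ : γ ∈ F} (with U_∅ = ω₁). Let τ be the topology on ω₁ generated by the family {U_γ : γ < ω₁} as a subbasis. If for every uncountable family B of pairwise disjoint finite subsets of ω₁ there is a countable B' ⊆ B such that ω₁ \ ⋃{U_F : F ∈ B'} is countable, then the space (ω₁, τ) is hereditarily Lindelöf. -/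
open Ordinal Set

/-- `ω₁` viewed as the set (type) of all countable ordinals. -/
abbrev Omega1 : Type 1 := {o : Ordinal // o < ω₁}

/-- The **Δ-system lemma** for finite sets. -/
theorem exists_uncountable_deltaSystem {α : Type*} [DecidableEq α] {S : Set (Finset α)}
    (hS : ¬ S.Countable) :
    ∃ (R : Finset α) (D : Set (Finset α)), D ⊆ S ∧ ¬ D.Countable ∧ (∀ F ∈ D, R ⊆ F) ∧
      D.PairwiseDisjoint (· \ R) := by
  obtain ⟨n, hn⟩ : ∃ n, ¬ {F ∈ S | F.card = n}.Countable := by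
    by_contra! hc
    refine hS ((countable_iUnion hc).mono fun F hF ↦ mem_iUnion.2 ⟨F.card, ?_⟩)
    exact ⟨hF, rfl⟩
  let T (R : Finset α) : Set (Finset α) := {F ∈ S | F.card = n ∧ R ⊆ F}
  obtain ⟨R, hR, hmax⟩ : ∃ R, ¬ (T R).Countable ∧ ∀ R', ¬ (T R').Countable → R'.card ≤ R.card := by
    have hbdd : BddAbove (Finset.card '' {R | ¬ (T R).Countable}) := by
      refine ⟨n, forall_mem_image.2 fun R hR ↦ ?_⟩
      obtain ⟨F, -, hF, hRF⟩ : (T R).Nonempty :=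
        nonempty_iff_ne_empty.2 fun h0 ↦ hR (h0 ▸ countable_empty)
      exact hF ▸ Finset.card_le_card hRF
    obtain ⟨_, ⟨R, hR, rfl⟩, hmax⟩ := hbdd.exists_isGreatest_of_nonempty
      ⟨_, mem_image_of_mem _ (show ¬ (T ∅).Countable by
        simpa only [T, Finset.empty_subset, and_true] using hn)⟩
    exact ⟨R, hR, fun R' hR' ↦ hmax (mem_image_of_mem _ hR')⟩
  have hcount : ∀ γ ∉ R, {F ∈ T R | γ ∈ F}.Countable := by
    intro γ hγ
    by_contra hc
    have := hmax (insert γ R) fun hcount ↦ by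
      refine hc (hcount.mono fun F hF ↦ ?_)
      exact ⟨hF.1.1, hF.1.2.1, Finset.insert_subset hF.2 hF.1.2.2⟩
    rw [Finset.card_insert_of_notMem hγ] at this
    omega
  obtain ⟨D, hD⟩ := zorn_subset {D | D ⊆ T R ∧ D.PairwiseDisjoint (· \ R)} fun c hc hchain ↦
    ⟨⋃₀ c, ⟨sUnion_subset fun D hD ↦ (hc hD).1,
      (pairwiseDisjoint_sUnion hchain.directedOn).2 fun D hD ↦ (hc hD).2⟩,
      fun _ ↦ subset_sUnion_of_mem⟩
  refine ⟨R, D, fun F hF ↦ (hD.prop.1 hF).1, fun hDc ↦ hR ?_, fun F hF ↦ (hD.prop.1 hF).2.2,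
    hD.prop.2⟩
  have hmeet : (D ∪ ⋃ G ∈ D, ⋃ γ ∈ G \ R, {F ∈ T R | γ ∈ F}).Countable :=
    hDc.union <| hDc.biUnion fun G _ ↦ (G \ R).countable_toSet.biUnion fun γ hγ ↦
      hcount γ (Finset.mem_sdiff.1 hγ).2
  refine hmeet.mono fun F hF ↦ ?_
  by_contra hF'
  simp only [mem_union, mem_iUnion, not_or, not_exists] at hF'
  refine hF'.1 (hD.le_of_ge ⟨insert_subset hF hD.prop.1, hD.prop.2.insert fun G hG _ ↦ ?_⟩
    (subset_insert F D) (mem_insert F D))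
  refine Finset.disjoint_left.2 fun γ hγF hγG ↦ hF'.2 G hG γ hγG ⟨hF, (Finset.mem_sdiff.1 hγF).1⟩

/-- If every uncountable disjoint family of finite sets of indices has a countable subfamily whose
intersections cover all but countably many points, then every union of finite intersections of the
`U γ` is covered by a countable subunion. -/
theorem exists_countable_biUnion_subset {α X : Type*} {U : α → Set X}
    (h : ∀ B : Set (Finset α), ¬ B.Countable → B.PairwiseDisjoint id →
      ∃ B' ⊆ B, B'.Countable ∧ (Set.univ \ ⋃ F ∈ B', ⋂ γ ∈ F, U γ).Countable)
    {β : Type*} [LinearOrder β] [WellFoundedLT β] (hβ : ∀ b : β, (Iic b).Countable)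
    {e : Finset α → β} (he : e.Injective) (𝓕 : Set (Finset α)) :
    ∃ 𝓖 ⊆ 𝓕, 𝓖.Countable ∧ ⋃ F ∈ 𝓕, ⋂ γ ∈ F, U γ ⊆ ⋃ F ∈ 𝓖, ⋂ γ ∈ F, U γ := by
  classical
  let 𝓖 : Set (Finset α) :=
    {G ∈ 𝓕 | ∃ x ∈ ⋂ γ ∈ G, U γ, ∀ F ∈ 𝓕, e F < e G → x ∉ ⋂ γ ∈ F, U γ}
  refine ⟨𝓖, fun _ hG ↦ hG.1, ?_, fun x hx ↦ ?_⟩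
  · by_contra hG
    obtain ⟨R, D, hDG, hD, hRD, hdisj⟩ := exists_uncountable_deltaSystem hG
    have hDx : ∀ G ∈ D, ∃ x ∈ ⋂ γ ∈ G, U γ, ∀ F ∈ 𝓕, e F < e G → x ∉ ⋂ γ ∈ F, U γ :=
      fun G hG ↦ (hDG hG).2
    obtain ⟨G, hG⟩ : D.Nonempty := nonempty_iff_ne_empty.2 fun h0 ↦ hD (h0 ▸ countable_empty)
    have : Nonempty X := ⟨(hDx G hG).choose⟩
    choose! x hxmem hxlt using hDx
    have hxinj : InjOn x D := by
      intro F hF G hG hFG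
      by_contra hne
      rcases lt_or_gt_of_ne (he.ne hne) with hlt | hlt
      · exact hxlt G hG F (hDG hF).1 hlt (hFG ▸ hxmem F hF)
      · exact hxlt F hF G (hDG hG).1 hlt (hFG ▸ hxmem G hG)
    have hinj : InjOn (· \ R) D := by
      intro F hF G hG hFG
      rw [← Finset.sdiff_union_of_subset (hRD F hF), ← Finset.sdiff_union_of_subset (hRD G hG)]
      exact congrArg (· ∪ R) hFG
    obtain ⟨B', hB'D, hB'c, hB'⟩ := h ((· \ R) '' D)
      (fun hc ↦ hD (countable_of_injective_of_countable_image hinj hc))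
      (hinj.pairwiseDisjoint_image.2 hdisj)
    obtain ⟨E, hED, rfl⟩ := subset_image_iff.1 hB'D
    have hE : E.Countable := countable_of_injective_of_countable_image (hinj.mono hED) hB'c
    have hbelow : (⋃ F ∈ E, e ⁻¹' Iic (e F)).Countable :=
      hE.biUnion fun F _ ↦ (hβ (e F)).preimage he
    have hexc : {F ∈ D | x F ∈ Set.univ \ ⋃ F ∈ (· \ R) '' E, ⋂ γ ∈ F, U γ}.Countable :=
      countable_of_injective_of_countable_image (hxinj.mono fun _ hF ↦ hF.1)
        (hB'.mono (image_subset_iff.2 fun _ hF ↦ hF.2))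
    refine hD ((hbelow.union hexc).mono fun H hH ↦ ?_)
    by_contra hHn
    simp only [mem_union, not_or, mem_iUnion, mem_preimage, mem_Iic, not_exists, not_le,
      mem_ofPred_eq, not_and, mem_sdiff, mem_univ, true_and, biUnion_image] at hHn
    obtain ⟨F, hF, hxF⟩ : ∃ F ∈ E, x H ∈ ⋂ γ ∈ F \ R, U γ := by
      by_contra! hc
      exact hHn.2 hH hc
    refine hxlt H hH F (hDG (hED hF)).1 (hHn.1 F hF) (mem_iInter₂.2 fun γ hγ ↦ ?_)
    by_cases hγR : γ ∈ R
    · exact mem_iInter₂.1 (hxmem H hH) γ (hRD H hH hγR)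
    · exact mem_iInter₂.1 hxF γ (Finset.mem_sdiff.2 ⟨hγ, hγR⟩)
  · obtain ⟨F, hF, hxF⟩ := mem_iUnion₂.1 hx
    obtain ⟨G, ⟨hG, hxG⟩, hmin⟩ := (InvImage.wf e wellFounded_lt).has_min
      {G ∈ 𝓕 | x ∈ ⋂ γ ∈ G, U γ} ⟨F, hF, hxF⟩
    exact mem_iUnion₂.2 ⟨G, ⟨hG, x, hxG, fun F hF hlt hxF ↦ hmin F ⟨hF, hxF⟩ hlt⟩, hxG⟩

/-- A topology generated by a family `U` is hereditarily Lindelöf as soon as every union of finite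
intersections of the `U γ` is covered by a countable subunion. -/
theorem hereditarilyLindelofSpace_generateFrom_range {α X : Type*} {U : α → Set X}
    (h : ∀ 𝓕 : Set (Finset α), ∃ 𝓖 ⊆ 𝓕, 𝓖.Countable ∧
      ⋃ F ∈ 𝓕, ⋂ γ ∈ F, U γ ⊆ ⋃ F ∈ 𝓖, ⋂ γ ∈ F, U γ) :
    @HereditarilyLindelofSpace X (TopologicalSpace.generateFrom (range U)) := by
  classical
  let := TopologicalSpace.generateFrom (range U)
  refine ⟨fun t _ ↦ isLindelof_of_countable_subcover fun {ι} W hW ht ↦ ?_⟩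
  obtain ⟨𝓖, h𝓖, h𝓖c, hcov⟩ := h {F | ∃ i, ⋂ γ ∈ F, U γ ⊆ W i}
  choose i hi using fun G : 𝓖 ↦ h𝓖 G.2
  have := h𝓖c.to_subtype
  refine ⟨range i, countable_range i, fun x hx ↦ ?_⟩
  obtain ⟨j, hj⟩ := mem_iUnion.1 (ht hx)
  obtain ⟨_, ⟨f, ⟨hf, hfU⟩, rfl⟩, hxf, hfW⟩ :=
    (TopologicalSpace.isTopologicalBasis_of_subbasis rfl).exists_subset_of_mem_open hj (hW j)
  obtain ⟨F, rfl⟩ : ∃ F : Finset α, U '' F = f := by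
    lift f to Finset (Set X) using hf
    rw [← image_univ] at hfU
    obtain ⟨F, -, rfl⟩ := Finset.subset_set_image_iff.1 hfU
    exact ⟨F, Finset.coe_image.symm⟩
  simp only [sInter_image, Finset.mem_coe] at hxf hfW
  obtain ⟨G, hG, hxG⟩ := mem_iUnion₂.1 (hcov (mem_iUnion₂.2 ⟨F, ⟨j, hfW⟩, hxf⟩))
  exact mem_iUnion₂.2 ⟨i ⟨G, hG⟩, mem_range_self _, hi ⟨G, hG⟩ hxG⟩

theorem Omega1.countable_Iic (a : Omega1) : (Iic a).Countable := by
  have h : (Iio a.1).Countable := by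
    rw [← Cardinal.le_aleph0_iff_set_countable, Cardinal.mk_Iio_ordinal, Cardinal.lift_le_aleph0,
      ← Order.lt_succ_iff, Cardinal.succ_aleph0, ← Cardinal.lt_ord, Cardinal.ord_aleph]
    exact a.2
  rw [← Iio_insert]
  exact (h.preimage Subtype.val_injective).insert a

instance Omega1.infinite : Infinite Omega1 :=
  Infinite.of_injective (fun n : ℕ ↦ ⟨n, (natCast_lt_omega0 n).trans omega0_lt_omega_one⟩)
    fun m n hmn ↦ by simpa using hmn

/-- If for every uncountable pairwise disjoint family `B` of finite subsets of `ω₁`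
there is a countable `B' ⊆ B` such that all but countably many points are covered by
the sets `U_F = ⋂ γ ∈ F, U γ` for `F ∈ B'`, then the topology generated by the `U γ`
as a subbasis is hereditarily Lindelöf. -/
theorem statement0 (U : Omega1 → Set Omega1)
    (h : ∀ B : Set (Finset Omega1), ¬ B.Countable → B.PairwiseDisjoint id →
      ∃ B' ⊆ B, B'.Countable ∧
        (Set.univ \ ⋃ F ∈ B', ⋂ γ ∈ F, U γ).Countable) :
    @HereditarilyLindelofSpace Omega1 (TopologicalSpace.generateFrom (Set.range U)) := by
  obtain ⟨e⟩ := Cardinal.eq.1 (Cardinal.mk_finset_of_infinite Omega1)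
  exact hereditarilyLindelofSpace_generateFrom_range
    (exists_countable_biUnion_subset h Omega1.countable_Iic e.injective)
end

section
/- Assume ◊. Then there exists a topology τ on ω₁ such that (ω₁, τ) is Hausdorff and hereditarily Lindelöf, and there is an open neighbourhood assignment γ ↦ U_γ (each U_γ is τ-open and γ ∈ U_γ) such that for every subset C ⊆ ω₁ that is closed and discrete in (ω₁, τ), the union ⋃{U_γ : γ ∈ C} is not all of ω₁. In particular, (ω₁, τ) is a Hausdorff hereditarily Lindelöf space of size ω₁ that is not a D-space. -/
open Ordinal Set

/-- `C ⊆ ω₁` is club: unbounded, and closed under limits of its elements. -/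
def IsClubIn (C : Set Omega1) : Prop :=
  (∀ a : Omega1, ∃ c ∈ C, a < c) ∧
  ∀ a : Omega1, (∃ b, b < a) → (∀ b < a, ∃ c ∈ C, b < c ∧ c < a) → a ∈ C

/-- `S ⊆ ω₁` is stationary: it meets every closed unbounded subset of `ω₁`. -/
def IsStationaryIn (S : Set Omega1) : Prop :=
  ∀ C : Set Omega1, IsClubIn C → (S ∩ C).Nonempty

/-- The diamond principle `◊`: there is a sequence `⟨A α : α < ω₁⟩` with `A α ⊆ α`
such that for every `B ⊆ ω₁` the set `{α | B ∩ α = A α}` is stationary in `ω₁`. -/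
def DiamondPrinciple : Prop :=
  ∃ A : Omega1 → Set Omega1,
    (∀ α : Omega1, A α ⊆ {β | β < α}) ∧
    ∀ B : Set Omega1, IsStationaryIn {α | B ∩ {β | β < α} = A α}

/-- A `T₁` space `X` is a `D`-space if for every open neighbourhood assignment
`x ↦ U x` there is a closed discrete `D ⊆ X` with `⋃ x ∈ D, U x = X`. -/
def IsDSpace (X : Type*) [TopologicalSpace X] : Prop :=
  ∀ U : X → Set X, (∀ x, IsOpen (U x) ∧ x ∈ U x) →
    ∃ D : Set X, IsClosed D ∧ DiscreteTopology D ∧ (⋃ x ∈ D, U x) = Set.univ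

namespace Omega1

theorem countable_Iio (a : Omega1) : (Iio a).Countable := by
  have h : (Iio a.1).Countable := by
    rw [← Cardinal.le_aleph0_iff_set_countable, Cardinal.mk_Iio_ordinal, Cardinal.lift_le_aleph0,
      ← Cardinal.lt_aleph_one_iff]
    exact Cardinal.lt_omega_iff_card_lt.1 a.2
  exact (h.preimage Subtype.val_injective).mono fun x hx ↦ hx

theorem countable_Iic_s3 (a : Omega1) : (Iic a).Countable := by
  rw [← Iio_insert]
  exact (countable_Iio a).insert a

theorem exists_gt_of_countable {S : Set Omega1} (hS : S.Countable) : ∃ δ, ∀ x ∈ S, x < δ := by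
  have := hS.to_subtype
  have := Countable.toSmall.{0} S
  have h : ⨆ x : S, x.1.1 + 1 < ω₁ := by
    refine Ordinal.iSup_lt_omega_one fun x ↦ ?_
    simpa using (Cardinal.isSuccLimit_omega 1).succ_lt x.1.2
  refine ⟨⟨_, h⟩, fun x hx ↦ ?_⟩
  have hle := le_ciSup (f := fun x : S ↦ x.1.1 + 1) Ordinal.bddAbove_of_small ⟨x, hx⟩
  exact Subtype.coe_lt_coe.1 ((Order.lt_add_one_iff.2 le_rfl).trans_le hle)

/-- Every function on `ω₁` has a positive closure point. -/
theorem exists_closed_lt (F : Omega1 → Omega1) :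
    ∃ β, (∃ b, b < β) ∧ ∀ b < β, F b < β := by
  have hnext : ∀ c : Omega1, ∃ d, ∀ b ≤ c, F b < d := fun c ↦ by
    obtain ⟨d, hd⟩ := exists_gt_of_countable ((countable_Iic_s3 c).image F)
    exact ⟨d, fun b hb ↦ hd _ (mem_image_of_mem F hb)⟩
  choose next hnext using hnext
  let c : ℕ → Omega1 := fun n ↦ next^[n] ⟨0, Ordinal.omega_pos 1⟩
  have hne : {d | ∀ n, c n < d}.Nonempty := by
    obtain ⟨d, hd⟩ := exists_gt_of_countable (countable_range c)
    exact ⟨d, fun n ↦ hd _ (mem_range_self n)⟩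
  let β := wellFounded_lt.min {d | ∀ n, c n < d} hne
  have hβ : ∀ n, c n < β := wellFounded_lt.min_mem _ hne
  refine ⟨β, ⟨_, hβ 0⟩, fun b hb ↦ ?_⟩
  obtain ⟨n, hn⟩ : ∃ n, b ≤ c n := by
    by_contra! h
    exact wellFounded_lt.not_lt_min {d | ∀ n, c n < d} h hb
  have : F b < c (n + 1) := by
    simp only [c, Function.iterate_succ_apply']
    exact hnext _ _ hn
  exact this.trans (hβ _)

/-- Some countable family of sets separates the points of `ω₁` in the Hausdorff sense. -/
theorem exists_separating_seq :
    ∃ V : ℕ → Set Omega1, ∀ x y, x ≠ y → ∃ m n, x ∈ V m ∧ y ∈ V n ∧ Disjoint (V m) (V n) := by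
  have h : Cardinal.lift.{0} (Cardinal.mk Omega1) ≤ Cardinal.lift.{1} (Cardinal.mk (Set ℕ)) := by
    have h1 : Cardinal.mk Omega1 = Cardinal.aleph 1 := by
      change Cardinal.mk (Iio ω₁) = _
      rw [Cardinal.mk_Iio_ordinal]
      simp
    rw [h1]
    simpa using Cardinal.aleph_one_le_continuum
  obtain ⟨f⟩ := Cardinal.lift_mk_le'.1 h
  let V : ℕ ⊕ ℕ → Set Omega1 := Sum.elim (fun n ↦ {x | n ∈ f x}) (fun n ↦ {x | n ∉ f x})
  have hV : ∀ x y, x ≠ y → ∃ m n, x ∈ V m ∧ y ∈ V n ∧ Disjoint (V m) (V n) := fun x y hxy ↦ by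
    obtain ⟨n, hn⟩ : ∃ n, ¬(n ∈ f x ↔ n ∈ f y) := by
      by_contra! h
      exact hxy (f.injective (Set.ext h))
    have hd : Disjoint (V (.inl n)) (V (.inr n)) := disjoint_left.2 fun z h1 h2 ↦ h2 h1
    by_cases hx : n ∈ f x
    · exact ⟨.inl n, .inr n, hx, fun hy ↦ hn (by tauto), hd⟩
    · exact ⟨.inr n, .inl n, hx, by_contra fun (hy : n ∉ f y) ↦ hn (by tauto), hd.symm⟩
  let e := Denumerable.eqv (ℕ ⊕ ℕ)
  refine ⟨V ∘ e.symm, fun x y hxy ↦ ?_⟩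
  obtain ⟨m, n, h⟩ := hV x y hxy
  exact ⟨e m, e n, by simpa using h⟩

/-- A diamond sequence enumerates all countable subsets of `ω₁`. -/
theorem exists_eq_of_countable {A : Omega1 → Set Omega1}
    (hA : ∀ B : Set Omega1, IsStationaryIn {α | B ∩ {β | β < α} = A α})
    {C : Set Omega1} (hC : C.Countable) : ∃ α, A α = C := by
  obtain ⟨δ, hδ⟩ := exists_gt_of_countable hC
  have hclub : IsClubIn (Ioi δ) := by
    refine ⟨fun a ↦ ?_, fun a ⟨b, hb⟩ h ↦ ?_⟩
    · obtain ⟨d, hd⟩ := exists_gt_of_countable (toFinite {a, δ}).countable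
      exact ⟨d, hd δ (by simp), hd a (by simp)⟩
    · obtain ⟨c, hc, -, hca⟩ := h b hb
      exact lt_trans hc hca
  obtain ⟨α, hα, hδα⟩ := hA C _ hclub
  refine ⟨α, hα.symm.trans (inter_eq_left.2 fun x hx ↦ ?_)⟩
  exact (hδ x hx).trans hδα

/-- `A α` has no accumulation point below `α`, for the topology generated by the sets `V n` and
`assignment V A γ`. -/
def Sparse (V : ℕ → Set Omega1) (A : Omega1 → Set Omega1) (α : Omega1) : Prop :=
  ∀ ξ, (_ : ξ < α) → ∃ (P : Finset ℕ) (G : Finset Omega1),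
    ((∀ n ∈ P, ξ ∈ V n) ∧ ∀ γ ∈ G, ¬(Sparse V A ξ ∧ γ ∈ A ξ)) ∧
    ∀ y, (_ : y < α) → y ∈ A α → y ≠ ξ →
      ¬((∀ n ∈ P, y ∈ V n) ∧ ∀ γ ∈ G, ¬(Sparse V A y ∧ γ ∈ A y))
termination_by α.1

/-- The neighbourhood assignment: `α` is removed from the neighbourhoods of all `γ ∈ A α`,
provided that `A α` is sparse. -/
def assignment (V : ℕ → Set Omega1) (A : Omega1 → Set Omega1) (γ : Omega1) : Set Omega1 :=
  {y | ¬(Sparse V A y ∧ γ ∈ A y)}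

/-- The basic open sets. -/
def basicOpen (V : ℕ → Set Omega1) (A : Omega1 → Set Omega1) (P : Finset ℕ)
    (G : Finset Omega1) : Set Omega1 :=
  {y | (∀ n ∈ P, y ∈ V n) ∧ ∀ γ ∈ G, y ∈ assignment V A γ}

/-- The topology generated by the sets `V n` and `assignment V A γ`. -/
abbrev topology (V : ℕ → Set Omega1) (A : Omega1 → Set Omega1) : TopologicalSpace Omega1 :=
  .generateFrom (range V ∪ range (assignment V A))

open Topology

variable {V : ℕ → Set Omega1} {A : Omega1 → Set Omega1}

theorem sparse_iff (hA : ∀ α, A α ⊆ {β | β < α}) {α : Omega1} :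
    Sparse V A α ↔ ∀ ξ < α, ∃ P G, ξ ∈ basicOpen V A P G ∧
      ∀ y ∈ A α, y ≠ ξ → y ∉ basicOpen V A P G := by
  rw [Sparse]
  refine forall₂_congr fun ξ _ ↦ exists₂_congr fun P G ↦ and_congr Iff.rfl ?_
  exact ⟨fun h y hy ↦ h y (hA α hy) hy, fun h y _ hy ↦ h y hy⟩

theorem mem_assignment_of_le (hA : ∀ α, A α ⊆ {β | β < α}) {y γ : Omega1} (h : y ≤ γ) :
    y ∈ assignment V A γ :=
  fun hy ↦ h.not_gt (hA y hy.2)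

theorem isOpen_V (n : ℕ) : IsOpen[topology V A] (V n) :=
  .basic _ (.inl ⟨n, rfl⟩)

theorem isOpen_assignment (γ : Omega1) : IsOpen[topology V A] (assignment V A γ) :=
  .basic _ (.inr ⟨γ, rfl⟩)

theorem exists_basicOpen_subset {O : Set Omega1} (hO : IsOpen[topology V A] O) {x : Omega1}
    (hx : x ∈ O) : ∃ P G, x ∈ basicOpen V A P G ∧ basicOpen V A P G ⊆ O := by
  classical
  induction hO with
  | basic s hs =>
    obtain ⟨n, rfl⟩ | ⟨γ, rfl⟩ := hs
    · exact ⟨{n}, ∅, by simpa [basicOpen] using hx, fun y hy ↦ hy.1 n (by simp)⟩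
    · exact ⟨∅, {γ}, by simpa [basicOpen] using hx, fun y hy ↦ hy.2 γ (by simp)⟩
  | univ => exact ⟨∅, ∅, by simp [basicOpen], subset_univ _⟩
  | inter s t _ _ ihs iht =>
    obtain ⟨P, G, h, hs⟩ := ihs hx.1
    obtain ⟨Q, H, h', ht⟩ := iht hx.2
    have key : basicOpen V A (P ∪ Q) (G ∪ H) = basicOpen V A P G ∩ basicOpen V A Q H := by
      ext y
      simp only [basicOpen, Finset.mem_union, or_imp, forall_and, mem_inter_iff, mem_ofPred_eq]
      tauto
    exact ⟨P ∪ Q, G ∪ H, key ▸ ⟨h, h'⟩, key ▸ inter_subset_inter hs ht⟩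
  | sUnion S _ ih =>
    obtain ⟨s, hs, hxs⟩ := hx
    obtain ⟨P, G, h, h'⟩ := ih s hs hxs
    exact ⟨P, G, h, h'.trans (subset_sUnion_of_mem hs)⟩

/-- An unbounded family of tuples contains a countable subfamily such that almost every point
lies in all neighbourhoods assigned to the entries of some tuple of the subfamily. -/
theorem exists_countable_subfamily_of_unbounded (hA : ∀ α, A α ⊆ {β | β < α}) {ι : Type*} {m : ℕ}
    (g : ι → Fin m → Omega1) (I : Set ι) (hI : ∀ β, ∃ i ∈ I, ∀ k, β ≤ g i k) :
    ∃ J ⊆ I, J.Countable ∧ ∃ δ, ∀ y > δ, ∃ i ∈ J, ∀ k, y ∈ assignment V A (g i k) := by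
  classical
  obtain ⟨i₀, hi₀, -⟩ := hI ⟨0, Ordinal.omega_pos 1⟩
  let Good (p : (Fin m → Finset ℕ) × (Fin m → Finset Omega1)) (i : ι) : Prop :=
    i ∈ I ∧ ∀ k, g i k ∈ basicOpen V A (p.1 k) (p.2 k)
  have hpick : ∀ p, ∃ i ∈ I, (∃ i, Good p i) → Good p i := fun p ↦ by
    by_cases h : ∃ i, Good p i
    · obtain ⟨i, hi⟩ := h
      exact ⟨i, hi.1, fun _ ↦ hi⟩
    · exact ⟨i₀, hi₀, fun h' ↦ (h h').elim⟩
  choose pick hpickI hpick using hpick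
  let below (S : Set Omega1) : Set ((Fin m → Finset ℕ) × (Fin m → Finset Omega1)) :=
    {p | ∀ k, (p.2 k : Set Omega1) ⊆ S}
  have hbelow : ∀ S : Set Omega1, S.Countable → (below S).Countable := fun S hS ↦ by
    have h1 : {G : Finset Omega1 | (G : Set Omega1) ⊆ S}.Countable := by
      have h : {t : Set Omega1 | t.Finite ∧ t ⊆ S}.Countable := countable_ofPred_finite_subset hS
      refine (h.preimage Finset.coe_injective).mono fun G hG ↦ ?_
      exact ⟨G.finite_toSet, hG⟩
    have h2 : {G : Fin m → Finset Omega1 | ∀ k, G k ∈ {G : Finset Omega1 | (G : Set Omega1) ⊆ S}}.Countable :=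
      countable_pi fun _ ↦ h1
    refine ((to_countable univ).prod h2).mono fun p hp ↦ ?_
    exact ⟨mem_univ _, hp⟩
  have hF : ∀ b, ∃ d, ∀ p ∈ below (Iic b), ∀ k, g (pick p) k < d := fun b ↦ by
    obtain ⟨d, hd⟩ := exists_gt_of_countable
      ((hbelow _ (countable_Iic_s3 b)).biUnion fun p _ ↦ countable_range (g (pick p)))
    exact ⟨d, fun p hp k ↦ hd _ (mem_biUnion hp (mem_range_self k))⟩
  choose F hF using hF
  obtain ⟨β, ⟨b₀, hb₀⟩, hβ⟩ := exists_closed_lt F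
  have hlt : ∀ p ∈ below (Iio β), ∀ k, g (pick p) k < β := fun p hp k ↦ by
    let T := insert b₀ (Finset.univ.biUnion p.2)
    have hT : T.Nonempty := Finset.insert_nonempty _ _
    have hmax : T.max' hT < β := by
      rw [Finset.max'_lt_iff]
      intro x hx
      obtain rfl | hx := Finset.mem_insert.1 hx
      · exact hb₀
      · obtain ⟨j, -, hj⟩ := Finset.mem_biUnion.1 hx
        exact hp j hj
    refine (hF (T.max' hT) p (fun j x hx ↦ ?_) k).trans (hβ _ hmax)
    exact Finset.le_max' _ _ (Finset.mem_insert_of_mem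
      (Finset.mem_biUnion.2 ⟨j, Finset.mem_univ j, hx⟩))
  obtain ⟨i, hi, hiβ⟩ := hI β
  obtain ⟨δ, hδ⟩ := exists_gt_of_countable (countable_range (g i))
  refine ⟨pick '' below (Iio β), image_subset_iff.2 fun p _ ↦ hpickI p,
    (hbelow _ (countable_Iio β)).image pick, δ, fun y hy ↦ ?_⟩
  by_cases hs : Sparse V A y
  · have hs' := (sparse_iff hA).1 hs
    choose P G hPG hsep using fun k ↦ hs' (g i k) ((hδ _ (mem_range_self k)).trans hy)
    let p : (Fin m → Finset ℕ) × (Fin m → Finset Omega1) := ⟨P, fun k ↦ (G k).filter (· < β)⟩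
    have hp : p ∈ below (Iio β) := fun k x hx ↦ by
      simpa [p] using (Finset.mem_filter.1 hx).2
    have hgood := hpick p ⟨i, hi, fun k ↦
      ⟨(hPG k).1, fun γ hγ ↦ (hPG k).2 γ (Finset.mem_filter.1 hγ).1⟩⟩
    refine ⟨_, mem_image_of_mem pick hp, fun k hk ↦ ?_⟩
    have hkβ := hlt p hp k
    refine hsep k _ hk.2 (hkβ.trans_le (hiβ k)).ne ⟨(hgood.2 k).1, fun γ hγ ↦ ?_⟩
    by_cases hγβ : γ < β
    · exact (hgood.2 k).2 γ (Finset.mem_filter.2 ⟨hγ, hγβ⟩)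
    · exact mem_assignment_of_le hA (hkβ.le.trans (not_lt.1 hγβ))
  · have hp : (⟨fun _ ↦ ∅, fun _ ↦ ∅⟩ : (Fin m → Finset ℕ) × (Fin m → Finset Omega1)) ∈
        below (Iio β) := fun k ↦ by simp
    exact ⟨_, mem_image_of_mem pick hp, fun k hk ↦ hs hk.1⟩

theorem exists_countable_subfamily (hA : ∀ α, A α ⊆ {β | β < α}) {ι : Type*} (m : ℕ)
    (g : ι → Fin m → Omega1) (I : Set ι) :
    ∃ J ⊆ I, J.Countable ∧ ∀ i ∈ I, ∀ y, (∀ k, y ∈ assignment V A (g i k)) →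
      ∃ j ∈ J, ∀ k, y ∈ assignment V A (g j k) := by
  induction m generalizing I with
  | zero =>
    obtain rfl | ⟨i, hi⟩ := I.eq_empty_or_nonempty
    · exact ⟨∅, subset_rfl, countable_empty, by simp⟩
    · exact ⟨{i}, by simpa using hi, countable_singleton i, by simp⟩
  | succ m ih =>
    by_cases hI : ∀ β, ∃ i ∈ I, ∀ k, β ≤ g i k
    · obtain ⟨J, hJI, hJ, δ, hδ⟩ := exists_countable_subfamily_of_unbounded (V := V) hA g I hI
      obtain ⟨i₀, hi₀, -⟩ := hI δ
      have hpick : ∀ y, ∃ i ∈ I, ∀ j ∈ I, (∀ k, y ∈ assignment V A (g j k)) →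
          ∀ k, y ∈ assignment V A (g i k) := fun y ↦ by
        by_cases h : ∃ j ∈ I, ∀ k, y ∈ assignment V A (g j k)
        · obtain ⟨j, hj, hy⟩ := h
          exact ⟨j, hj, fun _ _ _ ↦ hy⟩
        · exact ⟨i₀, hi₀, fun j hj hy ↦ (h ⟨j, hj, hy⟩).elim⟩
      choose pick hpickI hpick using hpick
      refine ⟨J ∪ pick '' Iic δ, union_subset hJI (image_subset_iff.2 fun y _ ↦ hpickI y),
        hJ.union ((countable_Iic_s3 δ).image pick), fun i hi y hy ↦ ?_⟩
      obtain hyδ | hyδ := le_or_gt y δ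
      · exact ⟨pick y, .inr (mem_image_of_mem pick hyδ), hpick y i hi hy⟩
      · obtain ⟨j, hj, h⟩ := hδ y hyδ
        exact ⟨j, .inl hj, h⟩
    · push Not at hI
      obtain ⟨β, hβ⟩ := hI
      choose J hJI hJ hJy using fun (k : Fin (m + 1)) (s : Omega1) ↦
        ih (fun i ↦ g i ∘ k.succAbove) {i ∈ I | g i k = s}
      refine ⟨⋃ k, ⋃ s ∈ Iio β, J k s, ?_, ?_, fun i hi y hy ↦ ?_⟩
      · exact iUnion_subset fun k ↦ iUnion₂_subset fun s _ ↦ (hJI k s).trans (sep_subset _ _)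
      · exact countable_iUnion fun k ↦ (countable_Iio β).biUnion fun s _ ↦ hJ k s
      · obtain ⟨k, hk⟩ := hβ i hi
        obtain ⟨j, hj, h⟩ := hJy k (g i k) i ⟨hi, rfl⟩ y fun l ↦ hy _
        refine ⟨j, mem_iUnion.2 ⟨k, mem_biUnion hk hj⟩, k.forall_iff_succAbove.2 ⟨?_, h⟩⟩
        rw [(hJI _ _ hj).2]
        exact hy k

theorem hereditarilyLindelofSpace_topology (hA : ∀ α, A α ⊆ {β | β < α}) :
    @HereditarilyLindelofSpace Omega1 (topology V A) := by
  let _ := topology V A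
  refine ⟨fun t _ ↦ isLindelof_of_countable_subcover fun {ι} W hW ht ↦ ?_⟩
  have h : ∀ x : t, ∃ (i : ι) (P : Finset ℕ) (G : Finset Omega1),
      x.1 ∈ basicOpen V A P G ∧ basicOpen V A P G ⊆ W i := fun x ↦ by
    obtain ⟨i, hi⟩ := mem_iUnion.1 (ht x.2)
    exact ⟨i, exists_basicOpen_subset (hW i) hi⟩
  choose c P G hx hsub using h
  have henum : ∀ (x : t) (m : ℕ), ∃ g : Fin m → Omega1, (G x).card = m →
      ∀ γ, γ ∈ G x ↔ ∃ k, g k = γ := fun x m ↦ by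
    by_cases hm : (G x).card = m
    · refine ⟨fun k ↦ ((G x).equivFinOfCardEq hm).symm k, fun _ γ ↦ ⟨fun hγ ↦ ?_, ?_⟩⟩
      · exact ⟨(G x).equivFinOfCardEq hm ⟨γ, hγ⟩, by simp⟩
      · rintro ⟨k, rfl⟩
        exact Subtype.coe_prop _
    · exact ⟨fun _ ↦ x, fun h ↦ (hm h).elim⟩
  choose g hg using henum
  choose J hJI hJ hJy using fun (Q : Finset ℕ) (m : ℕ) ↦
    exists_countable_subfamily (V := V) hA m (fun x : t ↦ g x m) {x | P x = Q ∧ (G x).card = m}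
  refine ⟨c '' ⋃ Q, ⋃ m, J Q m,
    (countable_iUnion fun Q ↦ countable_iUnion fun m ↦ hJ Q m).image c, fun x hxt ↦ ?_⟩
  have hxG := hx ⟨x, hxt⟩
  obtain ⟨j, hj, h⟩ := hJy (P ⟨x, hxt⟩) (G ⟨x, hxt⟩).card ⟨x, hxt⟩ ⟨rfl, rfl⟩ x
    fun k ↦ hxG.2 _ ((hg _ _ rfl _).2 ⟨k, rfl⟩)
  obtain ⟨hjP, hjG⟩ := hJI _ _ hj
  refine mem_biUnion (mem_image_of_mem c (mem_iUnion₂.2 ⟨_, _, hj⟩)) (hsub j ⟨?_, fun γ hγ ↦ ?_⟩)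
  · rw [hjP]
    exact hxG.1
  · obtain ⟨k, rfl⟩ := (hg _ _ hjG γ).1 hγ
    exact h k

theorem sparse_of_isClosed_of_discreteTopology (hA : ∀ α, A α ⊆ {β | β < α}) {α : Omega1}
    (hc : @IsClosed Omega1 (topology V A) (A α))
    (hd : @DiscreteTopology (A α) (.induced Subtype.val (topology V A))) : Sparse V A α := by
  let _ := topology V A
  refine (sparse_iff hA).2 fun ξ _ ↦ ?_
  obtain ⟨O, hO, hξ, hsep⟩ : ∃ O : Set Omega1, IsOpen O ∧ ξ ∈ O ∧ ∀ y ∈ A α, y ≠ ξ → y ∉ O := by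
    by_cases hξ : ξ ∈ A α
    · obtain ⟨O, hO, h⟩ := isOpen_induced_iff.1 (isOpen_discrete ({⟨ξ, hξ⟩} : Set (A α)))
      have key : ∀ y (hy : y ∈ A α), y ∈ O ↔ y = ξ := fun y hy ↦ by
        simpa using Set.ext_iff.1 h ⟨y, hy⟩
      exact ⟨O, hO, (key ξ hξ).2 rfl, fun y hy hne hyO ↦ hne ((key y hy).1 hyO)⟩
    · exact ⟨(A α)ᶜ, hc.isOpen_compl, hξ, fun y hy _ hy' ↦ hy' hy⟩
  obtain ⟨P, G, h, h'⟩ := exists_basicOpen_subset hO hξ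
  exact ⟨P, G, h, fun y hy hne hyB ↦ hsep y hy hne (h' hyB)⟩

end Omega1

/-- Assuming `◊`, there is a Hausdorff hereditarily Lindelöf topology `τ` on `ω₁`
together with an open neighbourhood assignment `γ ↦ U γ` such that no closed discrete
set `C` satisfies `⋃ γ ∈ C, U γ = ω₁`; in particular `(ω₁, τ)` is not a `D`-space. -/
theorem statement3 (hd : DiamondPrinciple) :
    ∃ τ : TopologicalSpace Omega1,
      @T2Space Omega1 τ ∧ @HereditarilyLindelofSpace Omega1 τ ∧
      ∃ U : Omega1 → Set Omega1,
        (∀ γ : Omega1, τ.IsOpen (U γ) ∧ γ ∈ U γ) ∧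
        ∀ C : Set Omega1, @IsClosed Omega1 τ C →
          @DiscreteTopology C (TopologicalSpace.induced (Subtype.val : C → Omega1) τ) →
          (⋃ γ ∈ C, U γ) ≠ Set.univ := by
  obtain ⟨A, hA, hstat⟩ := hd
  obtain ⟨V, hV⟩ := Omega1.exists_separating_seq
  have hL := Omega1.hereditarilyLindelofSpace_topology (V := V) hA
  refine ⟨Omega1.topology V A, ?_, hL, Omega1.assignment V A,
    fun γ ↦ ⟨Omega1.isOpen_assignment γ, Omega1.mem_assignment_of_le hA le_rfl⟩,
    fun C hC hdisc hU ↦ ?_⟩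
  · let _ := Omega1.topology V A
    refine ⟨fun x y hxy ↦ ?_⟩
    obtain ⟨m, n, h⟩ := hV x y hxy
    exact ⟨V m, V n, Omega1.isOpen_V m, Omega1.isOpen_V n, h⟩
  · let _ := Omega1.topology V A
    have hcount : C.Countable := countable_of_Lindelof_of_discrete (X := C)
    obtain ⟨α, rfl⟩ := Omega1.exists_eq_of_countable hstat hcount
    obtain ⟨γ, hγ, h⟩ := mem_iUnion₂.1 (hU.symm ▸ mem_univ α)
    exact h ⟨Omega1.sparse_of_isClosed_of_discreteTopology hA hC hdisc, hγ⟩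
end
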